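/- arXiv:0711.4959 — 3 statements merged into one kernel-verified Lean document; each statement's English description precedes it below -/
import Mathlib

section
/- Let 𝔫 be a Lie algebra over a field k and let · : 𝔫 × 𝔫 → 𝔫 be a bilinear product such that: (a) [X,Y] = X·Y − Y·X for all X, Y ∈ 𝔫; (b) X·(Y·Z) = Y·(X·Z) for all X, Y, Z ∈ 𝔫 (left multiplications commute); (c) for each X ∈ 𝔫 the left multiplication L(X) : Y ↦ X·Y is a derivation of the Lie bracket of 𝔫, i.e. X·[Y,Z] = [X·Y, Z] + [Y, X·Z]. Then also (X·Y)·Z = (X·Z)·Y for all X, Y, Z ∈ 𝔫, so that · is an LR-structure on 𝔫. -/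
/-- If `·` is a bilinear product on a Lie algebra `𝔫` inducing the Lie bracket as its
commutator, with commuting left multiplications, and such that each left multiplication
is a derivation of the Lie bracket, then the right multiplications also commute,
i.e. `·` is an LR-structure on `𝔫`. -/
theorem lr_structure_of_left_commuting_derivations
    (k : Type) [Field k] (𝔫 : Type) [LieRing 𝔫] [LieAlgebra k 𝔫]
    (mul : 𝔫 →ₗ[k] 𝔫 →ₗ[k] 𝔫)
    (hcomm : ∀ X Y : 𝔫, ⁅X, Y⁆ = mul X Y - mul Y X)
    (hleft : ∀ X Y Z : 𝔫, mul X (mul Y Z) = mul Y (mul X Z))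
    (hder : ∀ X Y Z : 𝔫, mul X ⁅Y, Z⁆ = ⁅mul X Y, Z⁆ + ⁅Y, mul X Z⁆) :
    ∀ X Y Z : 𝔫, mul (mul X Y) Z = mul (mul X Z) Y := by
  intro X Y Z
  have h := hder X Y Z
  rw [hcomm, hcomm, hcomm, map_sub, hleft X Y Z, hleft X Z Y] at h
  linear_combination (norm := module) -h
end

section
/- Let 𝔫 be a Lie algebra over a field k equipped with an LR-structure · (that is, X·(Y·Z) = Y·(X·Z), (X·Y)·Z = (X·Z)·Y, and [X,Y] = X·Y − Y·X for all X, Y, Z ∈ 𝔫). Then for each X ∈ 𝔫 the left multiplication L(X) : Y ↦ X·Y is a derivation of the Lie bracket of 𝔫, i.e. X·[Y,Z] = [X·Y, Z] + [Y, X·Z] for all X, Y, Z ∈ 𝔫. -/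
/-- If `·` is an LR-structure on a Lie algebra `𝔫` over a field `k`, then every left
multiplication `L(X) : Y ↦ X · Y` is a derivation of the Lie bracket of `𝔫`. -/
theorem left_multiplications_of_lr_structure_are_derivations
    (k : Type) [Field k] (𝔫 : Type) [LieRing 𝔫] [LieAlgebra k 𝔫]
    (mul : 𝔫 →ₗ[k] 𝔫 →ₗ[k] 𝔫)
    (hleft : ∀ X Y Z : 𝔫, mul X (mul Y Z) = mul Y (mul X Z))
    (hright : ∀ X Y Z : 𝔫, mul (mul X Y) Z = mul (mul X Z) Y)
    (hcomm : ∀ X Y : 𝔫, ⁅X, Y⁆ = mul X Y - mul Y X) :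
    ∀ X Y Z : 𝔫, mul X ⁅Y, Z⁆ = ⁅mul X Y, Z⁆ + ⁅Y, mul X Z⁆ := by
  intro X Y Z
  rw [hcomm, hcomm, hcomm, map_sub, hright X Y Z, hleft Z X Y, hleft Y X Z]
  abel
end

section
/- Let (A, ·) be an LR-algebra over a field k, i.e. a (not necessarily associative) algebra whose bilinear product satisfies X·(Y·Z) = Y·(X·Z) and (X·Y)·Z = (X·Z)·Y for all X, Y, Z ∈ A. Then the commutator [X,Y] := X·Y − Y·X satisfies the Jacobi identity, so (A, [·,·]) is a Lie algebra (LR-algebras are Lie-admissible). -/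
/-- LR-algebras are Lie-admissible: in an algebra whose left multiplications commute and
whose right multiplications commute, the commutator `[X,Y] = X·Y − Y·X` satisfies the
Jacobi identity. -/
theorem lr_algebra_is_lie_admissible
    (k : Type) [Field k] (A : Type) [AddCommGroup A] [Module k A]
    (mul : A →ₗ[k] A →ₗ[k] A)
    (hleft : ∀ X Y Z : A, mul X (mul Y Z) = mul Y (mul X Z))
    (hright : ∀ X Y Z : A, mul (mul X Y) Z = mul (mul X Z) Y) :
    ∀ X Y Z : A,
      (mul (mul X Y - mul Y X) Z - mul Z (mul X Y - mul Y X)) +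
      (mul (mul Y Z - mul Z Y) X - mul X (mul Y Z - mul Z Y)) +
      (mul (mul Z X - mul X Z) Y - mul Y (mul Z X - mul X Z)) = 0 := by
  intro X Y Z
  simp only [map_sub, LinearMap.sub_apply]
  rw [hright X Y Z, hright Y X Z, hright Z X Y, hleft Z X Y, hleft Z Y X, hleft X Y Z]
  abel
end
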